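/- For all real numbers x, v with 0 < x < 1/4 and 0 < v ≤ 1, setting t = 1/(2√x), the following series converges and A(x,v) = (v/C(x))·Σ_{j≥1} √x / ((U_{j−1}(t) − v√x·U_{j−2}(t))·(U_j(t) − v√x·U_{j−1}(t))). -/

import Mathlib

/-- A Catalan word: a word `a : Fin n → ℕ` satisfying (i) `a (i+1) ≥ a i - 1` for all
adjacent positions, and (ii) if `i` is the minimal index with `a i = k > 0`, then there
exist `i₁ < i < i₂` with `a i₁ = a i₂ = k - 1`. -/
def IsCatalanWord {n : ℕ} (a : Fin n → ℕ) : Prop :=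
  (∀ (i : ℕ) (h : i + 1 < n), a ⟨i, Nat.lt_of_succ_lt h⟩ ≤ a ⟨i + 1, h⟩ + 1) ∧
  (∀ i : Fin n, 0 < a i → (∀ j : Fin n, a j = a i → i ≤ j) →
    ((∃ i₁ : Fin n, i₁ < i ∧ a i₁ + 1 = a i) ∧ (∃ i₂ : Fin n, i < i₂ ∧ a i₂ + 1 = a i)))

/-- The number of letters of the word `a` equal to `c`. -/
noncomputable def countEq {n : ℕ} (a : Fin n → ℕ) (c : ℕ) : ℕ :=
  Set.ncard {i : Fin n | a i = c}

/-- `aZ n m` is the number of Catalan words of length `n` with exactly `m` zeros. -/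
noncomputable def aZ (n m : ℕ) : ℕ :=
  Set.ncard {a : Fin n → ℕ | IsCatalanWord a ∧ countEq a 0 = m}

/-- `C(x) = (1 - √(1-4x))/(2x)`, the generating function of the Catalan numbers. -/
noncomputable def Cfun (x : ℝ) : ℝ := (1 - Real.sqrt (1 - 4*x)) / (2*x)

/-- The `n`-th term (a finite sum over `m`) of the double series
`A(x,u) = Σ_{n≥1} Σ_{m=1}^n a(n,m) xⁿ uᵐ`.  (The term for `n = 0` is `0`.) -/
noncomputable def Aterm (x u : ℝ) (n : ℕ) : ℝ :=
  ∑ m ∈ Finset.Icc 1 n, (aZ n m : ℝ) * x ^ n * u ^ m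

/-- Evaluation at `t` of the `n`-th Chebyshev polynomial of the second kind, with the
index extended to all integers by the recurrence `U n = 2x·U (n-1) - U (n-2)`
(so `U (-1) = 0`, `U (-2) = -1`). -/
noncomputable def chebU (n : ℤ) (t : ℝ) : ℝ := (Polynomial.Chebyshev.U ℝ n).eval t

/-- Adjacent letters of the word descend by at most one. -/
abbrev SlowDescent (l : List ℕ) : Prop := List.IsChain (fun a b => a ≤ b + 1) l

/-- The first occurrence of `k + 1` in `l`, if any, has occurrences of `k` on both sides. -/
def FirstSuccBetween (k : ℕ) (l : List ℕ) : Prop :=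
  ∀ p s, l = p ++ (k + 1) :: s → k + 1 ∉ p → k ∈ p ∧ k ∈ s

/-- Catalan words, as lists. -/
def IsCatalanList (l : List ℕ) : Prop :=
  SlowDescent l ∧ ∀ k, FirstSuccBetween k l

/-- Delete the zeros of a word and decrease the other letters by one. -/
def lowerWord (l : List ℕ) : List ℕ :=
  l.filterMap fun a => match a with
    | 0 => none
    | k + 1 => some k

@[simp] lemma lowerWord_nil : lowerWord [] = [] := rfl

@[simp] lemma lowerWord_zero_cons (l : List ℕ) : lowerWord (0 :: l) = lowerWord l := rfl

@[simp] lemma lowerWord_succ_cons (k : ℕ) (l : List ℕ) :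
    lowerWord ((k + 1) :: l) = k :: lowerWord l := rfl

@[simp] lemma lowerWord_append (l l' : List ℕ) :
    lowerWord (l ++ l') = lowerWord l ++ lowerWord l' := by
  simp [lowerWord]

@[simp] lemma mem_lowerWord (k : ℕ) (l : List ℕ) : k ∈ lowerWord l ↔ k + 1 ∈ l := by
  induction l with
  | nil => simp
  | cons a l ih => cases a <;> simp [ih]

@[simp] lemma lowerWord_replicate_zero (m : ℕ) : lowerWord (List.replicate m 0) = [] := by
  induction m with
  | zero => rfl
  | succ m ih => simpa [List.replicate_succ] using ih

@[simp] lemma lowerWord_map_succ (b : List ℕ) : lowerWord (b.map Nat.succ) = b := by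
  induction b with
  | nil => rfl
  | cons a b ih => simpa using ih

lemma length_lowerWord (l : List ℕ) : (lowerWord l).length + l.count 0 = l.length := by
  induction l with
  | nil => rfl
  | cons a l ih => cases a <;> simp <;> omega

lemma eq_map_succ_lowerWord {l : List ℕ} (h : 0 ∉ l) : l = (lowerWord l).map Nat.succ := by
  induction l with
  | nil => rfl
  | cons a l ih =>
    cases a with
    | zero => simp at h
    | succ k => simpa using ih (by simpa using h)

lemma eq_replicate_of_lowerWord_eq_nil {l : List ℕ} (h : lowerWord l = []) :
    l = List.replicate l.length 0 := by
  refine List.eq_replicate_iff.2 ⟨rfl, fun a ha => ?_⟩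
  cases a with
  | zero => rfl
  | succ k =>
    rw [← mem_lowerWord, h] at ha
    simp at ha

lemma exists_of_lowerWord_eq {k : ℕ} {l p s : List ℕ} (h : lowerWord l = p ++ k :: s) :
    ∃ p' s', l = p' ++ (k + 1) :: s' ∧ lowerWord p' = p ∧ lowerWord s' = s := by
  induction l generalizing p with
  | nil => simp at h
  | cons a l ih =>
    cases a with
    | zero =>
      obtain ⟨p', s', rfl, hp, hs⟩ := ih (by simpa using h)
      exact ⟨0 :: p', s', rfl, by simpa using hp, hs⟩
    | succ a =>
      cases p with
      | nil =>
        simp only [lowerWord_succ_cons, List.nil_append, List.cons.injEq] at h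
        exact ⟨[], l, by simp [h.1], rfl, h.2⟩
      | cons b p =>
        simp only [lowerWord_succ_cons, List.cons_append, List.cons.injEq] at h
        obtain ⟨p', s', rfl, hp, hs⟩ := ih h.2
        exact ⟨(a + 1) :: p', s', rfl, by simp [h.1, hp], hs⟩

lemma firstSuccBetween_lowerWord (k : ℕ) (l : List ℕ) :
    FirstSuccBetween k (lowerWord l) ↔ FirstSuccBetween (k + 1) l := by
  constructor
  · rintro h p s rfl hp
    simpa using h (lowerWord p) (lowerWord s) (by simp) (by simpa using hp)
  · intro h p s hl hp
    obtain ⟨p', s', rfl, rfl, rfl⟩ := exists_of_lowerWord_eq hl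
    simpa using h p' s' rfl (by simpa using hp)

lemma slowDescent_zero_cons (l : List ℕ) : SlowDescent (0 :: l) ↔ SlowDescent l := by
  simp [SlowDescent, List.isChain_cons]

lemma SlowDescent.lowerWord_cons {l : List ℕ} :
    (SlowDescent l → SlowDescent (lowerWord l)) ∧
      ∀ p, SlowDescent (p :: l) → SlowDescent ((p - 1) :: lowerWord l) := by
  induction l with
  | nil => simp [SlowDescent]
  | cons a l ih =>
    have key : SlowDescent (a :: l) → SlowDescent (lowerWord (a :: l)) := by
      intro h
      cases a with
      | zero => exact ih.1 ((slowDescent_zero_cons l).1 h)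
      | succ a => exact ih.2 _ h
    refine ⟨key, fun p h => ?_⟩
    simp only [SlowDescent, List.isChain_cons_cons] at h
    cases a with
    | zero =>
      rw [show p - 1 = 0 by omega, slowDescent_zero_cons]
      exact key h.2
    | succ a =>
      simp only [SlowDescent, lowerWord_succ_cons, List.isChain_cons_cons]
      exact ⟨by omega, key h.2⟩

lemma isCatalanList_iff_lowerWord {l : List ℕ} (hl : SlowDescent l) :
    IsCatalanList l ↔ IsCatalanList (lowerWord l) ∧ FirstSuccBetween 0 l := by
  constructor
  · exact fun h => ⟨⟨SlowDescent.lowerWord_cons.1 hl,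
      fun k => (firstSuccBetween_lowerWord k l).2 (h.2 _)⟩, h.2 0⟩
  · refine fun h => ⟨hl, fun k => ?_⟩
    cases k with
    | zero => exact h.2
    | succ k => exact (firstSuccBetween_lowerWord k l).1 (h.1.2 k)

lemma IsCatalanList.head_eq_zero {a : ℕ} {l : List ℕ} (h : IsCatalanList (a :: l)) : a = 0 := by
  cases a with
  | zero => rfl
  | succ k => simpa using (h.2 k [] l rfl (by simp)).1

/-- The words `w` with `m` zeros and lowered word `b` such that `p :: w` descends slowly. -/
def zeroInsertions (p : ℕ) (b : List ℕ) (m : ℕ) : Set (List ℕ) :=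
  {w | SlowDescent (p :: w) ∧ lowerWord w = b ∧ w.count 0 = m}

lemma zeroInsertions_nil_zero (p : ℕ) : zeroInsertions p [] 0 = {[]} := by
  ext w
  cases w with
  | nil => simp [zeroInsertions, SlowDescent]
  | cons a w => cases a <;> simp [zeroInsertions]

lemma zeroInsertions_nil_succ (p m : ℕ) :
    zeroInsertions p [] (m + 1) =
      if p ≤ 1 then List.cons 0 '' zeroInsertions 0 [] m else ∅ := by
  ext w
  cases w with
  | nil => split_ifs <;> simp [zeroInsertions]
  | cons a w =>
    split_ifs with h <;> cases a <;> simp [zeroInsertions, SlowDescent, h]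

lemma zeroInsertions_cons_zero {p c : ℕ} (hpc : p ≤ c + 2) (b : List ℕ) :
    zeroInsertions p (c :: b) 0 = List.cons (c + 1) '' zeroInsertions (c + 1) b 0 := by
  ext w
  cases w with
  | nil => simp [zeroInsertions]
  | cons a w =>
    cases a with
    | zero => simp [zeroInsertions]
    | succ a =>
      simp only [zeroInsertions, SlowDescent, List.isChain_cons_cons, lowerWord_succ_cons,
        List.cons.injEq, Set.mem_ofPred_eq, Set.mem_image]
      grind

lemma zeroInsertions_cons_succ {p c : ℕ} (hpc : p ≤ c + 2) (b : List ℕ) (m : ℕ) :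
    zeroInsertions p (c :: b) (m + 1) =
      (if p ≤ 1 then List.cons 0 '' zeroInsertions 0 (c :: b) m else ∅) ∪
        List.cons (c + 1) '' zeroInsertions (c + 1) b (m + 1) := by
  ext w
  cases w with
  | nil => split_ifs <;> simp [zeroInsertions]
  | cons a w =>
    cases a with
    | zero => split_ifs with h <;> simp [zeroInsertions, SlowDescent, h]
    | succ a =>
      have : (a + 1) :: w ∉ (if p ≤ 1 then List.cons 0 '' zeroInsertions 0 (c :: b) m else ∅) := by
        split_ifs <;> simp
      simp only [Set.mem_union, this, false_or]
      simp only [zeroInsertions, SlowDescent, List.isChain_cons_cons, lowerWord_succ_cons,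
        List.cons.injEq, Set.mem_ofPred_eq, Set.mem_image]
      grind

lemma encard_zeroInsertions (b : List ℕ) : ∀ (m p : ℕ), SlowDescent ((p - 1) :: b) →
    (zeroInsertions p b m).encard = Nat.multichoose (((p - 1) :: b).count 0) m := by
  induction b with
  | nil =>
    intro m
    induction m with
    | zero => intro p _; simp [zeroInsertions_nil_zero]
    | succ m ih =>
      intro p _
      rw [zeroInsertions_nil_succ]
      split_ifs with h
      · rw [List.cons_injective.encard_image, ih 0 (by simp [SlowDescent])]
        simp [show p - 1 = 0 by omega]
      · have : p - 1 ≠ 0 := by omega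
        simp [this]
  | cons c b ihb =>
    intro m
    induction m with
    | zero =>
      intro p h
      simp only [SlowDescent, List.isChain_cons_cons] at h
      rw [zeroInsertions_cons_zero (by omega), List.cons_injective.encard_image, ihb 0 (c + 1) h.2]
      simp
    | succ m ih =>
      intro p h
      simp only [SlowDescent, List.isChain_cons_cons] at h
      rw [zeroInsertions_cons_succ (by omega), Set.encard_union_eq,
        List.cons_injective.encard_image, ihb _ (c + 1) h.2]
      · split_ifs with hp
        · rw [List.cons_injective.encard_image, ih 0 (by simpa [SlowDescent] using h.2),
            show p - 1 = 0 by omega, Nat.add_sub_cancel, List.count_cons_self,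
            Nat.multichoose_succ_succ]
          simp [add_comm]
        · have : p - 1 ≠ 0 := by omega
          simp [List.count_cons, this]
      · rw [Set.disjoint_left]
        split_ifs
        · rintro _ ⟨w, _, rfl⟩ ⟨w', _, h⟩
          simp at h
        · simp

/-- The Catalan words of length `n` with `m` zeros, as lists. -/
def catalanLists (n m : ℕ) : Set (List ℕ) :=
  {l | IsCatalanList l ∧ l.length = n ∧ l.count 0 = m}

lemma exists_append_of_not_firstSuccBetween_zero {w : List ℕ} (hw : IsCatalanList (lowerWord w))
    (h : ¬ FirstSuccBetween 0 (0 :: w)) :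
    0 :: w = List.replicate (w.count 0 + 1) 0 ++ (lowerWord w).map Nat.succ := by
  simp only [FirstSuccBetween, not_forall] at h
  obtain ⟨p, s, hps, hp, h0⟩ := h
  have hp0 : 0 ∈ p := by
    cases p with
    | nil => simp at hps
    | cons a p => simp at hps; simp [← hps.1]
  have hs : 0 ∉ s := fun hs => h0 ⟨hp0, hs⟩
  have hlow : lowerWord w = lowerWord p ++ 0 :: lowerWord s := by
    have := congrArg lowerWord hps
    simpa using this
  have hpnil : lowerWord p = [] := by
    cases hq : lowerWord p with
    | nil => rfl
    | cons a q =>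
      have ha : a = 0 := by
        rw [hlow, hq] at hw
        exact hw.head_eq_zero
      have : 0 ∈ lowerWord p := by simp [hq, ha]
      simp at this
      exact absurd this hp
  have hcount : w.count 0 + 1 = p.length := by
    have h1 := congrArg (List.count 0) hps
    have h2 := length_lowerWord p
    rw [hpnil] at h2
    simp [List.count_eq_zero.2 hs] at h1 h2
    omega
  rw [hcount, ← eq_replicate_of_lowerWord_eq_nil hpnil, hps, hlow, hpnil]
  simpa using eq_map_succ_lowerWord hs

lemma not_firstSuccBetween_zero_replicate_append {b : List ℕ} (m : ℕ) :
    ¬ FirstSuccBetween 0 (List.replicate m 0 ++ ((0 :: b).map Nat.succ)) := by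
  intro h
  have := (h (List.replicate m 0) (b.map Nat.succ) (by simp) (by simp)).2
  simp at this

lemma encard_fiber_add_one {b : List ℕ} (hb : IsCatalanList b) (hb0 : b ≠ []) (m : ℕ) :
    {l | IsCatalanList l ∧ lowerWord l = b ∧ l.count 0 = m + 1}.encard + 1 =
      Nat.multichoose (b.count 0 + 1) m := by
  have hins := encard_zeroInsertions b m 0 ((slowDescent_zero_cons b).2 hb.1)
  rw [← (List.cons_injective (a := 0)).encard_image] at hins
  rw [show b.count 0 + 1 = ((0 - 1) :: b).count 0 by simp, ← hins]
  obtain ⟨c, b, rfl⟩ := List.exists_cons_of_ne_nil hb0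
  obtain rfl := hb.head_eq_zero
  rw [← Set.encard_insert_of_notMem
    (a := List.replicate (m + 1) 0 ++ ((0 :: b).map Nat.succ))]
  · congr 1
    ext l
    simp only [Set.mem_insert_iff, Set.mem_ofPred_eq, Set.mem_image, zeroInsertions]
    constructor
    · rintro (rfl | ⟨hl, hlow, hcount⟩)
      · refine ⟨List.replicate m 0 ++ ((0 :: b).map Nat.succ), ⟨?_, ?_, ?_⟩, ?_⟩
        · have : SlowDescent ((0 :: b).map Nat.succ) := by
            have := hb.1
            simp only [SlowDescent, List.isChain_map] at this ⊢
            exact this.imp fun _ _ h => by simpa using h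
          rw [slowDescent_zero_cons]
          clear hins
          induction m with
          | zero => simpa using this
          | succ m ih => rwa [List.replicate_succ, List.cons_append, slowDescent_zero_cons]
        · rw [lowerWord_append, lowerWord_map_succ]; simp
        · simp [List.count_eq_zero]
        · simp [List.replicate_succ]
      · cases l with
        | nil => simp at hlow
        | cons a w =>
          obtain rfl := hl.head_eq_zero
          exact ⟨w, ⟨hl.1, by simpa using hlow, by simpa using hcount⟩, rfl⟩
    · rintro ⟨w, ⟨hw, hlow, hcount⟩, rfl⟩
      by_cases h : FirstSuccBetween 0 (0 :: w)
      · right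
        refine ⟨(isCatalanList_iff_lowerWord hw).2 ⟨?_, h⟩, by simpa using hlow,
          by simpa using hcount⟩
        simpa [hlow] using hb
      · left
        rw [exists_append_of_not_firstSuccBetween_zero (hlow ▸ hb) h, hlow, hcount]
  · exact fun h => not_firstSuccBetween_zero_replicate_append _ (h.1.2 0)

lemma IsCatalanList.mem_of_le {l : List ℕ} (h : IsCatalanList l) {j k : ℕ} (hk : k ∈ l)
    (hjk : j ≤ k) : j ∈ l := by
  induction k with
  | zero => simpa [Nat.le_zero.1 hjk] using hk
  | succ k ih =>
    rcases hjk.eq_or_lt with rfl | hlt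
    · exact hk
    · obtain ⟨p, s, rfl, hp⟩ := List.eq_append_cons_of_mem hk
      have := (h.2 k p s rfl hp).1
      exact ih (by simp [this]) (by omega)

lemma IsCatalanList.lt_length {l : List ℕ} (h : IsCatalanList l) {k : ℕ} (hk : k ∈ l) :
    k < l.length := by
  have hsub : Finset.range (k + 1) ⊆ l.toFinset := fun j hj => by
    simpa using h.mem_of_le hk (by simpa [Nat.lt_succ_iff] using hj)
  have := (Finset.card_le_card hsub).trans l.toFinset_card_le
  simpa using this

lemma finite_setOf_isCatalanList (n : ℕ) : {l | IsCatalanList l ∧ l.length = n}.Finite := by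
  refine ((Set.finite_Iic (fun _ : Fin n => n)).image List.ofFn).subset ?_
  rintro l ⟨hl, rfl⟩
  exact ⟨l.get, fun i => (hl.lt_length (List.get_mem l i)).le, List.ofFn_get l⟩

lemma finite_catalanLists (n m : ℕ) : (catalanLists n m).Finite :=
  (finite_setOf_isCatalanList n).subset fun _ h => ⟨h.1, h.2.1⟩

lemma catalanLists_self (m : ℕ) : catalanLists m m = {List.replicate m 0} := by
  ext l
  simp only [catalanLists, Set.mem_ofPred_eq, Set.mem_singleton_iff]
  constructor
  · rintro ⟨_, h1, h2⟩
    have h := length_lowerWord l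
    have hlen : (lowerWord l).length = 0 := by omega
    have := eq_replicate_of_lowerWord_eq_nil (List.length_eq_zero_iff.1 hlen)
    rwa [h1] at this
  · rintro rfl
    refine ⟨⟨?_, fun k p s h hp => ?_⟩, by simp, by simp⟩
    · simp [SlowDescent, List.isChain_iff_getElem]
    · have : k + 1 ∈ List.replicate m 0 := by simp [h]
      simp at this

lemma IsCatalanList.count_zero_mem_Icc {l : List ℕ} (h : IsCatalanList l) (hl : l ≠ []) :
    l.count 0 ∈ Finset.Icc 1 l.length := by
  obtain ⟨a, l, rfl⟩ := List.exists_cons_of_ne_nil hl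
  obtain rfl := h.head_eq_zero
  exact Finset.mem_Icc.2 ⟨by simp, List.count_le_length⟩

lemma ncard_catalanLists_add (n m : ℕ) (hn : n ≠ 0) :
    (catalanLists (n + (m + 1)) (m + 1)).ncard + ∑ i ∈ Finset.Icc 1 n, (catalanLists n i).ncard =
      ∑ i ∈ Finset.Icc 1 n, (catalanLists n i).ncard * Nat.multichoose (i + 1) m := by
  classical
  set s := (finite_setOf_isCatalanList n).toFinset with hs
  have hmem : ∀ b, b ∈ s ↔ IsCatalanList b ∧ b.length = n := by simp [hs]
  have hmaps : ∀ b ∈ s, b.count 0 ∈ Finset.Icc 1 n := by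
    intro b hb
    obtain ⟨hc, rfl⟩ := (hmem b).1 hb
    exact hc.count_zero_mem_Icc (by rintro rfl; simp at hn)
  have hfib : ∀ i, (catalanLists n i).ncard = (s.filter (fun b => b.count 0 = i)).card := by
    intro i
    rw [← Set.ncard_coe_finset]
    congr 1
    ext b
    simp [hmem, catalanLists, and_assoc]
  have hsum : ∀ f : ℕ → ℕ, ∑ i ∈ Finset.Icc 1 n, (catalanLists n i).ncard * f i =
      ∑ b ∈ s, f (b.count 0) := by
    intro f
    rw [← Finset.sum_fiberwise_of_maps_to hmaps]
    refine Finset.sum_congr rfl fun i _ => ?_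
    rw [Finset.sum_congr rfl (g := fun _ => f i) (fun b hb => by rw [(Finset.mem_filter.1 hb).2]),
      hfib]
    simp
  have h1 := hsum fun _ => 1
  simp only [mul_one] at h1
  rw [hsum fun i => Nat.multichoose (i + 1) m, h1]
  set t := (finite_catalanLists (n + (m + 1)) (m + 1)).toFinset with ht
  have hmemt : ∀ l, l ∈ t ↔ IsCatalanList l ∧ l.length = n + (m + 1) ∧ l.count 0 = m + 1 := by
    simp [ht, catalanLists]
  have htmaps : ∀ l ∈ t, lowerWord l ∈ s := by
    intro l hl
    obtain ⟨hl, hlen, hcount⟩ := (hmemt l).1 hl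
    have := length_lowerWord l
    exact (hmem _).2 ⟨((isCatalanList_iff_lowerWord hl.1).1 hl).1, by omega⟩
  rw [Set.ncard_eq_toFinset_card _ (finite_catalanLists _ _), ← ht,
    Finset.card_eq_sum_card_fiberwise htmaps, ← Finset.sum_add_distrib]
  refine Finset.sum_congr rfl fun b hb => ?_
  obtain ⟨hb, hlen⟩ := (hmem b).1 hb
  have := encard_fiber_add_one hb (by rintro rfl; simp at hlen; omega) m
  rw [← ENat.natCast_inj, ← this, Nat.cast_add, Nat.cast_one, ← Set.encard_coe_eq_coe_finsetCard]
  congr 2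
  ext l
  simp only [Finset.coe_filter, hmemt, Set.mem_ofPred_eq]
  have := length_lowerWord l
  constructor
  · rintro ⟨⟨h1, h2, h3⟩, h4⟩
    exact ⟨h1, h4, h3⟩
  · rintro ⟨h1, rfl, h3⟩
    exact ⟨⟨h1, by omega, h3⟩, rfl⟩

lemma isCatalanWord_iff_ofFn {n : ℕ} (a : Fin n → ℕ) :
    IsCatalanWord a ↔ IsCatalanList (List.ofFn a) := by
  refine and_congr ?_ ?_
  · rw [SlowDescent, List.isChain_ofFn]
  · constructor
    · intro h k p s hps hp
      have hlen := congrArg List.length hps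
      simp only [List.length_ofFn, List.length_append, List.length_cons] at hlen
      have hget : ∀ (j : Fin n), a j = (p ++ (k + 1) :: s)[(j : ℕ)]'(by simp; omega) := by
        intro j
        simp [← hps]
      have hi : a ⟨p.length, by omega⟩ = k + 1 := by simp [hget]
      obtain ⟨⟨i₁, h₁, h₁'⟩, ⟨i₂, h₂, h₂'⟩⟩ := h ⟨p.length, by omega⟩ (by omega) (by
        intro j hj
        rw [hi, hget] at hj
        by_contra hlt
        have hlt' : (j : ℕ) < p.length := by simpa [Fin.lt_def] using hlt
        rw [List.getElem_append_left hlt'] at hj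
        exact hp (hj ▸ List.getElem_mem _))
      rw [hi] at h₁' h₂'
      rw [Fin.lt_def] at h₁ h₂
      constructor
      · rw [hget, List.getElem_append_left h₁] at h₁'
        exact (Nat.succ_injective h₁') ▸ List.getElem_mem _
      · have hpos : 0 < (i₂ : ℕ) - p.length := by simpa using h₂
        obtain ⟨d, hd⟩ : ∃ d, (i₂ : ℕ) - p.length = d + 1 := ⟨_, (Nat.sub_add_cancel hpos).symm⟩
        rw [hget, List.getElem_append_right h₂.le] at h₂'
        simp only [hd, List.getElem_cons_succ] at h₂'
        exact (Nat.succ_injective h₂') ▸ List.getElem_mem _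
    · intro h i hpos hmin
      obtain ⟨k, hk⟩ : ∃ k, a i = k + 1 := ⟨a i - 1, by omega⟩
      have hi : (i : ℕ) < (List.ofFn a).length := by simp
      have hsplit : List.ofFn a =
          (List.ofFn a).take i ++ (k + 1) :: (List.ofFn a).drop (i + 1) := by
        conv_lhs => rw [← List.take_append_drop i (List.ofFn a), List.drop_eq_getElem_cons hi]
        simp [hk]
      obtain ⟨h₁, h₂⟩ := h k _ _ hsplit (by
        intro hmem
        obtain ⟨j, hj, hj'⟩ := List.mem_take_iff_getElem.1 hmem
        have hjn : j < n := by omega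
        have := hmin ⟨j, hjn⟩ (by simpa [hk] using hj')
        rw [Fin.le_def] at this
        simp at this
        omega)
      rw [hk]
      constructor
      · obtain ⟨j, hj, hj'⟩ := List.mem_take_iff_getElem.1 h₁
        exact ⟨⟨j, by omega⟩, by rw [Fin.lt_def]; simp; omega, by simpa using hj'⟩
      · obtain ⟨j, hj, hj'⟩ := List.mem_drop_iff_getElem.1 h₂
        have hjn : i + 1 + j < n := by simpa [add_comm, add_left_comm] using hj
        exact ⟨⟨i + 1 + j, hjn⟩, by rw [Fin.lt_def]; simp; omega, by simpa using hj'⟩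

lemma countEq_eq_count_ofFn {n : ℕ} (a : Fin n → ℕ) (c : ℕ) :
    countEq a c = (List.ofFn a).count c := by
  classical
  have h := Fin.card_filter_univ_eq_vector_get_eq_count c (List.Vector.ofFn a)
  rw [List.Vector.toList_ofFn] at h
  rw [← h, countEq, ← Set.ncard_coe_finset]
  congr 1
  ext i
  simp [eq_comm]

lemma aZ_eq_ncard_catalanLists (n m : ℕ) : aZ n m = (catalanLists n m).ncard := by
  rw [aZ, ← Set.ncard_image_of_injective _ List.ofFn_injective]
  congr 1
  ext l
  simp only [Set.mem_image, Set.mem_ofPred_eq, catalanLists, isCatalanWord_iff_ofFn,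
    countEq_eq_count_ofFn]
  constructor
  · rintro ⟨a, ⟨h1, h2⟩, rfl⟩
    exact ⟨h1, by simp, h2⟩
  · rintro ⟨h1, rfl, h2⟩
    exact ⟨l.get, by simpa [List.ofFn_get] using ⟨h1, h2⟩, List.ofFn_get l⟩

lemma sum_Icc_one_eq_sum_range {M : Type*} [AddCommMonoid M] (f : ℕ → M) (n : ℕ) :
    ∑ i ∈ Finset.Icc 1 n, f i = ∑ i ∈ Finset.range n, f (i + 1) := by
  rw [Finset.range_eq_Ico, Finset.sum_Ico_add' f 0 n 1]
  rfl

section CatalanPowers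

open PowerSeries

lemma X_pow_dvd_sum_range_sub_pow {R : Type*} [CommRing R] {c y x : R} (hcy : (1 - y) * c = 1)
    (hxy : x ∣ y) (n m : ℕ) :
    x ^ n ∣ ∑ i ∈ Finset.range n, y ^ i * ((i + m).choose m : R) - c ^ (m + 1) := by
  have hyn : x ^ n ∣ y ^ n := pow_dvd_pow_of_dvd hxy n
  induction m with
  | zero =>
    have h : ∑ i ∈ Finset.range n, y ^ i * ((i + 0).choose 0 : R) - c ^ (0 + 1) = -(y ^ n * c) := by
      simp only [Nat.choose_zero_right, Nat.cast_one, mul_one]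
      linear_combination c * mul_neg_geom_sum y n - (∑ i ∈ Finset.range n, y ^ i) * hcy
    rw [h]
    exact (dvd_neg).2 (hyn.mul_right c)
  | succ m ih =>
    have tel : ∀ k : ℕ, (1 - y) * ∑ i ∈ Finset.range k, y ^ i * ((i + (m + 1)).choose (m + 1) : R) =
        ∑ i ∈ Finset.range k, y ^ i * ((i + m).choose m : R) -
          y ^ k * ((k + m).choose (m + 1) : R) := by
      intro k
      induction k with
      | zero => simp
      | succ k ihk =>
        rw [Finset.sum_range_succ, Finset.sum_range_succ, mul_add, ihk]
        have : ((k + (m + 1)).choose (m + 1) : R) = (k + m).choose m + (k + m).choose (m + 1) := by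
          rw [← add_assoc, Nat.choose_succ_succ]; push_cast; ring
        rw [show k + 1 + m = k + (m + 1) by ring, this]
        ring
    have h := (ih.sub (hyn.mul_right ((n + m).choose (m + 1) : R))).mul_left c
    convert h using 1
    linear_combination c * tel n
      - (∑ i ∈ Finset.range n, y ^ i * ((i + (m + 1)).choose (m + 1) : R)) * hcy

lemma sum_coeff_pow_mul_multichoose {c : ℤ⟦X⟧} (hc : c ^ 2 * X + 1 = c) {n : ℕ} (hn : n ≠ 0)
    (m : ℕ) :
    coeff n (c ^ m) + ∑ i ∈ Finset.range n, coeff (n - (i + 1)) (c ^ i) =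
      ∑ i ∈ Finset.range n, coeff (n - (i + 1)) (c ^ i) * (Nat.multichoose (i + 1 + 1) m : ℤ) := by
  have hcy : (1 - X * c) * c = 1 := by linear_combination -hc
  set T : ℕ → ℤ⟦X⟧ := fun m => ∑ i ∈ Finset.range n,
    X ^ (i + 1) * c ^ i * ((i + 1 + m).choose m : ℤ⟦X⟧) with hT
  have hcT : ∀ m, c * T m =
      ∑ i ∈ Finset.range (n + 1), (X * c) ^ i * ((i + m).choose m : ℤ⟦X⟧) - 1 := by
    intro m
    rw [Finset.sum_range_succ', hT, Finset.mul_sum]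
    simp only [pow_zero, zero_add, Nat.choose_self, Nat.cast_one, mul_one, add_sub_cancel_right]
    exact Finset.sum_congr rfl fun i _ => by ring
  have hdvd : X ^ (n + 1) ∣ T m - T 0 - (c ^ m - 1) := by
    have h := ((X_pow_dvd_sum_range_sub_pow hcy (dvd_mul_right X c) (n + 1) m).sub
      (X_pow_dvd_sum_range_sub_pow hcy (dvd_mul_right X c) (n + 1) 0)).mul_left (1 - X * c)
    convert h using 1
    linear_combination (1 - X * c) * hcT m - (1 - X * c) * hcT 0 - (T m - T 0 - (c ^ m - 1)) * hcy
  have hcoeff := (X_pow_dvd_iff.1 hdvd) n (Nat.lt_succ_self n)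
  have hTc : ∀ m, coeff n (T m) = ∑ i ∈ Finset.range n,
      coeff (n - (i + 1)) (c ^ i) * (Nat.multichoose (i + 1 + 1) m : ℤ) := by
    intro m
    rw [hT, map_sum]
    refine Finset.sum_congr rfl fun i hi => ?_
    have hle : i + 1 ≤ n := Finset.mem_range.1 hi
    rw [mul_assoc, coeff_X_pow_mul', if_pos hle, ← map_natCast (C (R := ℤ)), coeff_mul_C,
      Nat.multichoose_eq]
    simp [add_right_comm]
  rw [map_sub, map_sub, map_sub, hTc, hTc, coeff_one, if_neg hn] at hcoeff
  simp only [Nat.multichoose_zero_right, Nat.cast_one, mul_one] at hcoeff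
  linarith

lemma ncard_catalanLists (n m : ℕ) :
    (catalanLists (n + (m + 1)) (m + 1)).ncard = coeff n (catalanSeries ^ m) := by
  induction n using Nat.strong_induction_on generalizing m with
  | _ n ih =>
    rcases eq_or_ne n 0 with rfl | hn
    · rw [zero_add, catalanLists_self]
      simp [catalanSeries_constantCoeff]
    · have h := ncard_catalanLists_add n m hn
      have hih : ∀ i ∈ Finset.range n, (catalanLists n (i + 1)).ncard =
          coeff (n - (i + 1)) (catalanSeries ^ i) := by
        intro i hi
        have hle : i + 1 ≤ n := Finset.mem_range.1 hi
        rw [← ih (n - (i + 1)) (by omega) i, Nat.sub_add_cancel hle]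
      have hih' : ∑ i ∈ Finset.range n,
          (catalanLists n (i + 1)).ncard * Nat.multichoose (i + 1 + 1) m =
          ∑ i ∈ Finset.range n,
            coeff (n - (i + 1)) (catalanSeries ^ i) * Nat.multichoose (i + 1 + 1) m :=
        Finset.sum_congr rfl fun i hi => by rw [hih i hi]
      rw [sum_Icc_one_eq_sum_range, sum_Icc_one_eq_sum_range, Finset.sum_congr rfl hih, hih'] at h
      set φ := PowerSeries.map (Nat.castRingHom ℤ)
      have hφ : ∀ k j, coeff k (φ catalanSeries ^ j) = ((coeff k (catalanSeries ^ j) : ℕ) : ℤ) := by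
        intro k j
        rw [← map_pow, coeff_map]
        rfl
      have h' := sum_coeff_pow_mul_multichoose (c := φ catalanSeries) (by
        have := congrArg φ catalanSeries_sq_mul_X_add_one
        simpa [φ] using this) hn m
      simp only [hφ] at h'
      norm_cast at h'
      omega

end CatalanPowers

lemma mul_Cfun_sq {x : ℝ} (hx0 : 0 < x) (hx : x < 1 / 4) : x * Cfun x ^ 2 + 1 = Cfun x := by
  have h := Real.sq_sqrt (show 0 ≤ 1 - 4 * x by linarith)
  rw [Cfun]
  generalize Real.sqrt (1 - 4 * x) = r at h
  field_simp
  linear_combination h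

lemma Cfun_pos {x : ℝ} (hx0 : 0 < x) : 0 < Cfun x := by
  refine div_pos (sub_pos.2 ?_) (by linarith)
  rw [Real.sqrt_lt' one_pos]
  linarith

lemma two_mul_mul_Cfun_lt_one {x : ℝ} (hx0 : 0 < x) (hx : x < 1 / 4) : 2 * x * Cfun x < 1 := by
  have h : 2 * x * Cfun x = 1 - Real.sqrt (1 - 4 * x) := by
    rw [Cfun]
    field_simp
  have := Real.sqrt_pos.2 (show 0 < 1 - 4 * x by linarith)
  linarith

lemma sum_range_catalan_mul_pow_le {x : ℝ} (hx0 : 0 < x) (hx : x < 1 / 4) (n : ℕ) :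
    ∑ k ∈ Finset.range n, (catalan k : ℝ) * x ^ k ≤ Cfun x := by
  induction n with
  | zero => simpa using (Cfun_pos hx0).le
  | succ n ih =>
    have hnn : 0 ≤ ∑ k ∈ Finset.range n, (catalan k : ℝ) * x ^ k :=
      Finset.sum_nonneg fun _ _ => by positivity
    have hle : ∑ k ∈ Finset.range n, ∑ p ∈ Finset.HasAntidiagonal.antidiagonal k,
        ((catalan p.1 : ℝ) * x ^ p.1) * (catalan p.2 * x ^ p.2) ≤
        (∑ k ∈ Finset.range n, (catalan k : ℝ) * x ^ k) ^ 2 := by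
      rw [sq, Finset.sum_mul_sum, ← Finset.sum_product', ← Finset.sum_biUnion]
      · refine Finset.sum_le_sum_of_subset_of_nonneg ?_ fun _ _ _ => by positivity
        intro p hp
        simp only [Finset.mem_biUnion, Finset.HasAntidiagonal.mem_antidiagonal,
          Finset.mem_product, Finset.mem_range] at hp ⊢
        omega
      · intro i _ j _ hij
        simp only [Function.onFun, Finset.disjoint_left, Finset.HasAntidiagonal.mem_antidiagonal]
        intro p hi hj
        exact hij (hi.symm.trans hj)
    rw [Finset.sum_range_succ', catalan_zero, Nat.cast_one, pow_zero, mul_one]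
    have hrec : ∑ k ∈ Finset.range n, (catalan (k + 1) : ℝ) * x ^ (k + 1) =
        x * ∑ k ∈ Finset.range n, ∑ p ∈ Finset.HasAntidiagonal.antidiagonal k,
          ((catalan p.1 : ℝ) * x ^ p.1) * (catalan p.2 * x ^ p.2) := by
      rw [Finset.mul_sum]
      refine Finset.sum_congr rfl fun k _ => ?_
      rw [catalan_succ', Nat.cast_sum, Finset.sum_mul, Finset.mul_sum]
      refine Finset.sum_congr rfl fun p hp => ?_
      rw [← Finset.HasAntidiagonal.mem_antidiagonal.1 hp]
      push_cast
      ring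
    rw [hrec, ← mul_Cfun_sq hx0 hx]
    gcongr
    exact hle.trans (by gcongr)

lemma hasSum_mul_antidiagonal {f g : ℕ → ℝ} {a b : ℝ} (hf : HasSum f a) (hg : HasSum g b)
    (hf0 : 0 ≤ f) (hg0 : 0 ≤ g) :
    HasSum (fun n => ∑ p ∈ Finset.HasAntidiagonal.antidiagonal n, f p.1 * g p.2) (a * b) := by
  have hfg := hf.summable.mul_of_nonneg hg.summable hf0 hg0
  rw [← hf.tsum_eq, ← hg.tsum_eq,
    hf.summable.tsum_mul_tsum_eq_tsum_sum_antidiagonal hg.summable hfg]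
  exact (summable_sum_mul_antidiagonal_of_summable_mul hfg).hasSum

lemma hasSum_catalan_mul_pow {x : ℝ} (hx0 : 0 < x) (hx : x < 1 / 4) :
    HasSum (fun k => (catalan k : ℝ) * x ^ k) (Cfun x) := by
  have hnn : 0 ≤ fun k => (catalan k : ℝ) * x ^ k := fun k => by positivity
  have hs := summable_of_sum_range_le hnn (sum_range_catalan_mul_pow_le hx0 hx)
  set S := ∑' k, (catalan k : ℝ) * x ^ k with hS
  have hle : S ≤ Cfun x := hs.tsum_le_of_sum_range_le (sum_range_catalan_mul_pow_le hx0 hx)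
  have hsq := (hasSum_mul_antidiagonal hs.hasSum hs.hasSum hnn hnn).mul_left x
  have hshift : HasSum (fun k => (catalan (k + 1) : ℝ) * x ^ (k + 1)) (x * (S * S)) := by
    refine hsq.congr_fun fun k => ?_
    rw [catalan_succ', Nat.cast_sum, Finset.sum_mul, Finset.mul_sum]
    refine Finset.sum_congr rfl fun p hp => ?_
    rw [← Finset.HasAntidiagonal.mem_antidiagonal.1 hp]
    push_cast
    ring
  have hfix : S = 1 + x * (S * S) := by
    have h := hs.tsum_eq_zero_add
    rwa [hshift.tsum_eq, catalan_zero, Nat.cast_one, pow_zero, mul_one] at h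
  have hzero : (Cfun x - S) * (1 - x * (Cfun x + S)) = 0 := by
    linear_combination -hfix - mul_Cfun_sq hx0 hx
  have hlt : 0 < 1 - x * (Cfun x + S) := by
    nlinarith [two_mul_mul_Cfun_lt_one hx0 hx]
  have : S = Cfun x := by
    have := (mul_eq_zero.1 hzero).resolve_right hlt.ne'
    linarith
  exact this ▸ hs.hasSum

lemma hasSum_coeff_catalanSeries_pow {x : ℝ} (hx0 : 0 < x) (hx : x < 1 / 4) (j : ℕ) :
    HasSum (fun k => ((PowerSeries.catalanSeries ^ j).coeff k : ℝ) * x ^ k) (Cfun x ^ j) := by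
  induction j with
  | zero =>
    convert hasSum_ite_eq 0 (1 : ℝ) using 2 with k
    · by_cases hk : k = 0 <;> simp [PowerSeries.coeff_one, hk]
    · simp
  | succ j ih =>
    rw [pow_succ]
    rw [pow_succ (Cfun x)]
    refine (hasSum_mul_antidiagonal ih (hasSum_catalan_mul_pow hx0 hx)
      (fun k => by positivity) (fun k => by positivity)).congr_fun fun k => ?_
    rw [PowerSeries.coeff_mul, Nat.cast_sum, Finset.sum_mul]
    refine Finset.sum_congr rfl fun p hp => ?_
    rw [← Finset.HasAntidiagonal.mem_antidiagonal.1 hp, PowerSeries.catalanSeries_coeff]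
    push_cast
    ring

lemma Aterm_zero (x v : ℝ) : Aterm x v 0 = 0 := by simp [Aterm]

lemma Aterm_succ (x v : ℝ) (n : ℕ) :
    Aterm x v (n + 1) = ∑ p ∈ Finset.HasAntidiagonal.antidiagonal n,
      x * v * ((x * v) ^ p.1 * (((PowerSeries.catalanSeries ^ p.1).coeff p.2 : ℝ) * x ^ p.2)) := by
  rw [Aterm, Finset.Nat.sum_antidiagonal_eq_sum_range_succ
    (fun i j => x * v * ((x * v) ^ i * (((PowerSeries.catalanSeries ^ i).coeff j : ℝ) * x ^ j))),
    sum_Icc_one_eq_sum_range]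
  refine Finset.sum_congr rfl fun i hi => ?_
  obtain ⟨k, rfl⟩ : ∃ k, n = k + i := ⟨n - i, by have := Finset.mem_range.1 hi; omega⟩
  rw [aZ_eq_ncard_catalanLists, add_assoc, ncard_catalanLists, Nat.add_sub_cancel]
  ring

lemma hasSum_Aterm {x v : ℝ} (hx0 : 0 < x) (hx : x < 1 / 4) (hv0 : 0 < v) (hv1 : v ≤ 1) :
    HasSum (Aterm x v) (x * v / (1 - x * v * Cfun x)) := by
  have hC := Cfun_pos hx0
  have h2 := two_mul_mul_Cfun_lt_one hx0 hx
  have hr0 : 0 ≤ x * v * Cfun x := by positivity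
  have hr1 : x * v * Cfun x < 1 := by nlinarith [mul_pos hx0 hC]
  set f : ℕ × ℕ → ℝ := fun p =>
    x * v * ((x * v) ^ p.1 * (((PowerSeries.catalanSeries ^ p.1).coeff p.2 : ℝ) * x ^ p.2)) with hf
  have hrow : ∀ j, HasSum (fun k => f (j, k)) (x * v * (x * v * Cfun x) ^ j) := by
    intro j
    have := ((hasSum_coeff_catalanSeries_pow hx0 hx j).mul_left ((x * v) ^ j)).mul_left (x * v)
    rwa [← mul_pow] at this
  have hcol : HasSum (fun j => x * v * (x * v * Cfun x) ^ j) (x * v / (1 - x * v * Cfun x)) :=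
    (hasSum_geometric_of_lt_one hr0 hr1).mul_left (x * v)
  have hf0 : 0 ≤ f := fun p => by simp only [hf]; positivity
  have hfs : Summable f := by
    refine (summable_prod_of_nonneg hf0).2 ⟨fun j => (hrow j).summable, ?_⟩
    simp only [(hrow _).tsum_eq]
    exact hcol.summable
  have hfsum : HasSum f (x * v / (1 - x * v * Cfun x)) := by
    rw [← (hfs.hasSum.prod_fiberwise hrow).unique hcol]
    exact hfs.hasSum
  rw [← hasSum_nat_add_iff' 1]
  simp only [Finset.sum_range_one, Aterm_zero, sub_zero, Aterm_succ]
  have := (Finset.HasAntidiagonal.sigmaAntidiagonalEquivProd (A := ℕ)).hasSum_iff.2 hfsum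
  refine this.sigma fun n => ?_
  rw [← Finset.sum_attach]
  exact hasSum_fintype _

lemma chebU_add_two (n : ℤ) (t : ℝ) : chebU (n + 2) t = 2 * t * chebU (n + 1) t - chebU n t := by
  simp [chebU, Polynomial.Chebyshev.U_add_two]

lemma chebU_nat_sub_one {q : ℝ} (hq0 : 0 < q) (hq1 : q < 1) {t : ℝ} (ht : 2 * t = q + q⁻¹)
    (j : ℕ) : chebU ((j : ℤ) - 1) t = q / (1 - q ^ 2) * ((1 - (q ^ 2) ^ j) / q ^ j) := by
  have hq2 : 1 - q ^ 2 ≠ 0 := by nlinarith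
  induction j using Nat.twoStepInduction with
  | zero => simp [chebU]
  | one => simp [chebU]; field_simp
  | more j h1 h2 =>
    have h := chebU_add_two ((j : ℤ) - 1) t
    rw [show (j : ℤ) - 1 + 2 = ((j + 2 : ℕ) : ℤ) - 1 by push_cast; ring,
      show (j : ℤ) - 1 + 1 = ((j + 1 : ℕ) : ℤ) - 1 by push_cast; ring, h1, h2, ht] at h
    rw [h]
    field_simp
    ring

open Filter Topology in
lemma hasSum_inv_mul_telescope {q w t : ℝ} (hq0 : 0 < q) (hq1 : q < 1) (ht : 2 * t = q + q⁻¹)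
    (hw0 : 0 ≤ w) (hw : w * q < 1) :
    HasSum (fun j : ℕ => w / ((chebU j t - w * chebU ((j : ℤ) - 1) t) *
      (chebU ((j : ℤ) + 1) t - w * chebU j t))) (w * q / (1 - w * q)) := by
  have hq2 : 0 < 1 - q ^ 2 := by nlinarith
  set E : ℕ → ℝ := fun j => chebU ((j : ℤ) - 1) t with hE
  have hEform : ∀ j, E j = q / (1 - q ^ 2) * ((1 - (q ^ 2) ^ j) / q ^ j) :=
    chebU_nat_sub_one hq0 hq1 ht
  have hE1 : ∀ j : ℕ, chebU j t = E (j + 1) := fun j => by simp [hE]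
  have hE2 : ∀ j : ℕ, chebU ((j : ℤ) + 1) t = E (j + 2) := fun j => by
    simp only [hE]; congr 1; push_cast; ring
  have hrec : ∀ j, E (j + 2) = 2 * t * E (j + 1) - E j := fun j => by
    have h := chebU_add_two ((j : ℤ) - 1) t
    simp only [hE]
    convert h using 2
    · push_cast; ring
    · push_cast; ring_nf
  have hcassini : ∀ j, E (j + 1) ^ 2 - E (j + 2) * E j = 1 := by
    intro j
    induction j with
    | zero => simp [hE, chebU]
    | succ j ih =>
      rw [← ih, hrec (j + 1)]
      linear_combination E (j + 2) * hrec j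
  set e : ℕ → ℝ := fun j => 1 - (q ^ 2) ^ j with he
  have hpow : ∀ j, (q ^ 2) ^ (j + 1) ≤ (q ^ 2) ^ j := fun j =>
    pow_le_pow_of_le_one (by positivity) (by linarith) (Nat.le_succ j)
  have hepos : ∀ j, 0 < e (j + 1) := fun j =>
    sub_pos.2 (pow_lt_one₀ (by positivity) (by linarith) (Nat.succ_ne_zero j))
  have hdpos : ∀ j, 0 < e (j + 1) - w * q * e j := fun j => by
    have h1 := hepos j
    have h2 : e j ≤ e (j + 1) := by simp only [he]; linarith [hpow j]
    have h3 : 0 ≤ w * q := by positivity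
    nlinarith
  have hD : ∀ j, E (j + 1) - w * E j = (e (j + 1) - w * q * e j) / ((1 - q ^ 2) * q ^ j) := by
    intro j
    rw [hEform, hEform]
    simp only [he, pow_succ q]
    field_simp
  have hDpos : ∀ j, 0 < E (j + 1) - w * E j := fun j => by
    rw [hD]
    exact div_pos (hdpos j) (by positivity)
  have hterm : ∀ j : ℕ, w / ((chebU j t - w * chebU ((j : ℤ) - 1) t) *
      (chebU ((j : ℤ) + 1) t - w * chebU j t)) =
      E (j + 2) / (E (j + 2) - w * E (j + 1)) - E (j + 1) / (E (j + 1) - w * E j) := by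
    intro j
    rw [hE1, hE2, show chebU ((j : ℤ) - 1) t = E j from rfl,
      div_sub_div _ _ (hDpos (j + 1)).ne' (hDpos j).ne', mul_comm]
    congr 1
    linear_combination (-w) * hcassini j
  have hlim : Tendsto (fun j => E (j + 1) / (E (j + 1) - w * E j)) atTop (𝓝 (1 / (1 - w * q))) := by
    have hform : ∀ j, E (j + 1) / (E (j + 1) - w * E j) = e (j + 1) / (e (j + 1) - w * q * e j) := by
      intro j
      have := (hdpos j).ne'
      rw [hD, hEform]
      rw [div_div_eq_mul_div, mul_comm, ← mul_assoc]
      congr 1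
      simp only [he, pow_succ q]
      field_simp
    have hlim_e : Tendsto e atTop (𝓝 1) := by
      simpa using (tendsto_pow_atTop_nhds_zero_of_lt_one (sq_nonneg q) (by linarith)).const_sub 1
    have hlim_e1 := hlim_e.comp (tendsto_add_atTop_nat 1)
    have := hlim_e1.div (hlim_e1.sub (hlim_e.const_mul (w * q))) (by linarith)
    simp only [hform]
    rw [mul_one] at this
    exact this
  rw [hasSum_iff_tendsto_nat_of_nonneg]
  · simp only [hterm]
    simp only [Finset.sum_range_sub (fun j => E (j + 1) / (E (j + 1) - w * E j))]
    have h0 : E (0 + 1) / (E (0 + 1) - w * E 0) = 1 := by simp [hE, chebU]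
    rw [h0, show w * q / (1 - w * q) = 1 / (1 - w * q) - 1 by
      have : 1 - w * q ≠ 0 := by linarith
      field_simp; ring]
    exact hlim.sub_const 1
  · intro j
    rw [hE1, hE2, show chebU ((j : ℤ) - 1) t = E j from rfl]
    exact div_nonneg hw0 (mul_pos (hDpos j) (hDpos (j + 1))).le

/-- Chebyshev series expansion of `A(x,v)`:
`A(x,v) = (v/C(x)) Σ_{j≥1} √x / ((U_{j-1}(t) - v√x U_{j-2}(t))(U_j(t) - v√x U_{j-1}(t)))`
where `t = 1/(2√x)`.  The series over `j ≥ 1` is indexed here by `j : ℕ` via `j ↦ j + 1`. -/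
theorem A_chebyshev_series (x v : ℝ) (hx0 : 0 < x) (hx : x < 1/4) (hv0 : 0 < v) (hv1 : v ≤ 1) :
    Summable (Aterm x v) ∧
    Summable (fun j : ℕ => Real.sqrt x /
      ((chebU (j : ℤ) (1 / (2 * Real.sqrt x)) -
          v * Real.sqrt x * chebU ((j : ℤ) - 1) (1 / (2 * Real.sqrt x))) *
        (chebU ((j : ℤ) + 1) (1 / (2 * Real.sqrt x)) -
          v * Real.sqrt x * chebU (j : ℤ) (1 / (2 * Real.sqrt x))))) ∧
    ∑' n : ℕ, Aterm x v n =
      v / Cfun x * ∑' j : ℕ, Real.sqrt x /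
        ((chebU (j : ℤ) (1 / (2 * Real.sqrt x)) -
            v * Real.sqrt x * chebU ((j : ℤ) - 1) (1 / (2 * Real.sqrt x))) *
          (chebU ((j : ℤ) + 1) (1 / (2 * Real.sqrt x)) -
            v * Real.sqrt x * chebU (j : ℤ) (1 / (2 * Real.sqrt x)))) := by
  have hC := Cfun_pos hx0
  have hquad := mul_Cfun_sq hx0 hx
  have h2 := two_mul_mul_Cfun_lt_one hx0 hx
  have hA := hasSum_Aterm hx0 hx hv0 hv1
  have hs0 := Real.sqrt_pos.2 hx0
  have hsx := Real.sq_sqrt hx0.le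
  set s := Real.sqrt x
  have hq0 : 0 < s * Cfun x := by positivity
  have hq1 : s * Cfun x < 1 := by
    have : (s * Cfun x) ^ 2 < 1 := by
      rw [mul_pow, hsx]
      have : Cfun x < 2 := by nlinarith
      linarith
    nlinarith
  have ht : 2 * (1 / (2 * s)) = s * Cfun x + (s * Cfun x)⁻¹ := by
    field_simp
    rw [hsx]
    linarith
  have hwq : v * s * (s * Cfun x) = x * v * Cfun x := by rw [← hsx]; ring
  have hwq1 : x * v * Cfun x < 1 := by nlinarith [mul_pos hx0 hC]
  have hsum := (hasSum_inv_mul_telescope hq0 hq1 ht (w := v * s) (by positivity)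
    (by rw [hwq]; exact hwq1)).mul_left v⁻¹
  have hsum' : HasSum (fun j : ℕ => s / ((chebU (j : ℤ) (1 / (2 * s)) -
      v * s * chebU ((j : ℤ) - 1) (1 / (2 * s))) * (chebU ((j : ℤ) + 1) (1 / (2 * s)) -
      v * s * chebU (j : ℤ) (1 / (2 * s)))))
      (v⁻¹ * (v * s * (s * Cfun x) / (1 - v * s * (s * Cfun x)))) := by
    refine hsum.congr_fun fun j => ?_
    rw [← mul_div_assoc, inv_mul_cancel_left₀ hv0.ne']
  refine ⟨hA.summable, hsum'.summable, ?_⟩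
  rw [hA.tsum_eq, hsum'.tsum_eq, hwq]
  have : 1 - x * v * Cfun x ≠ 0 := by linarith
  field_simp
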